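/- arXiv:2503.10590 — 2 statements merged into one kernel-verified Lean document; each statement's English description precedes it below -/
import Mathlib

section
/- The number of irreducible complex characters χ of G with χ^c ≠ χ equals the number of conjugacy classes K of G with x K⁻¹ x⁻¹ ≠ K. -/
open scoped Classical

/-- `χ` is the character of an irreducible complex representation of `G`. -/
def IsIrrChar (G : Type) [Group G] (χ : G → ℂ) : Prop :=
  ∃ V : FDRep ℂ G, CategoryTheory.Simple V ∧ χ = V.character

/-- The Frobenius–Schur indicator of a function `χ` on a finite group `G`. -/
noncomputable def FS (G : Type) [Group G] [Finite G] (χ : G → ℂ) : ℂ :=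
  (∑ᶠ g : G, χ (g ^ 2)) / (Nat.card G : ℂ)

theorem conj_mem_of_index_two {Ghat : Type} [Group Ghat] {G : Subgroup Ghat} (h2 : G.index = 2)
    {g : Ghat} (hg : g ∈ G) (x : Ghat) : x * g * x⁻¹ ∈ G := by
  rw [Subgroup.mul_mem_iff_of_index_two h2, Subgroup.mul_mem_iff_of_index_two h2]
  simp [hg, Subgroup.inv_mem_iff]

/-- The twisted Frobenius–Schur indicator, summing over the coset `Ghat \ G`. -/
noncomputable def FSsharp {Ghat : Type} [Group Ghat] [Finite Ghat] (G : Subgroup Ghat)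
    (h2 : G.index = 2) (χ : ↥G → ℂ) : ℂ :=
  (∑ᶠ g ∈ {g : Ghat | g ∉ G}, χ ⟨g ^ 2, Subgroup.sq_mem_of_index_two h2 g⟩) / (Nat.card ↥G : ℂ)

/-- `χ^a`, the complex conjugate character. -/
def aChar {G : Type} [Group G] (χ : G → ℂ) : G → ℂ := fun g => starRingEnd ℂ (χ g)

/-- `χ^b : g ↦ χ(x g x⁻¹)`. -/
def bChar {Ghat : Type} [Group Ghat] {G : Subgroup Ghat} (h2 : G.index = 2) (x : Ghat)
    (χ : ↥G → ℂ) : ↥G → ℂ :=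
  fun g => χ ⟨x * ↑g * x⁻¹, conj_mem_of_index_two h2 g.2 x⟩

/-- `χ^c = conj(χ^b)`. -/
def cChar {Ghat : Type} [Group Ghat] {G : Subgroup Ghat} (h2 : G.index = 2) (x : Ghat)
    (χ : ↥G → ℂ) : ↥G → ℂ := aChar (bChar h2 x χ)

/-- `K` is a conjugacy class of `G`. -/
def IsConjClass (G : Type) [Group G] (K : Set G) : Prop := ∃ g : G, K = {h | IsConj g h}

/-- `K^b = xKx⁻¹`. -/
def bClass {Ghat : Type} [Group Ghat] {G : Subgroup Ghat} (h2 : G.index = 2) (x : Ghat)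
    (K : Set ↥G) : Set ↥G :=
  (fun g : ↥G => (⟨x * ↑g * x⁻¹, conj_mem_of_index_two h2 g.2 x⟩ : ↥G)) '' K

theorem trace_eq_card_of_repr_self {V ι : Type*} [AddCommGroup V] [Module ℂ V] [Finite ι]
    (b : Module.Basis ι ℂ V) (T : V →ₗ[ℂ] V) (p : ι → Prop) [DecidablePred p]
    (h : ∀ i, b.repr (T (b i)) i = if p i then 1 else 0) :
    LinearMap.trace ℂ V T = Nat.card {i // p i} := by
  classical
  have := Fintype.ofFinite ι
  rw [LinearMap.trace_eq_matrix_trace ℂ b, Matrix.trace]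
  simp [LinearMap.toMatrix_apply, h, Fintype.card_subtype]

theorem exists_eigenbasis_of_pow_eq_one {V : Type*} [AddCommGroup V] [Module ℂ V]
    [FiniteDimensional ℂ V] {f : Module.End ℂ V} {n : ℕ} (hn : n ≠ 0) (hf : f ^ n = 1) :
    ∃ (ι : Type) (_ : Finite ι) (b : Module.Basis ι ℂ V) (μ : ι → ℂ), ∀ i, f (b i) = μ i • b i := by
  classical
  have hs : f.IsSemisimple := by
    refine Module.End.isSemisimple_of_squarefree_aeval_eq_zero (p := Polynomial.X ^ n - Polynomial.C 1)
      (Polynomial.separable_X_pow_sub_C 1 (by exact_mod_cast hn) one_ne_zero).squarefree ?_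
    simp [hf]
  have hint : DirectSum.IsInternal fun μ : ℂ => f.eigenspace μ :=
    DirectSum.isInternal_submodule_of_iSupIndep_of_iSup_eq_top f.eigenspaces_iSupIndep
      hs.iSup_eigenspace_eq_top
  let b := hint.collectedBasis fun μ => Module.finBasis ℂ (f.eigenspace μ)
  exact ⟨_, Module.Finite.finite_basis b, b, Sigma.fst, fun i =>
    Module.End.mem_eigenspace_iff.mp (hint.collectedBasis_mem _ i)⟩

theorem Representation.character_inv_eq_conj {G V : Type*} [Group G] [Finite G]
    [AddCommGroup V] [Module ℂ V] [FiniteDimensional ℂ V] (ρ : Representation ℂ G V) (g : G) :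
    ρ.character g⁻¹ = starRingEnd ℂ (ρ.character g) := by
  classical
  have hn : Nat.card G ≠ 0 := Nat.card_pos.ne'
  have hg : ρ g ^ Nat.card G = 1 := by rw [← map_pow, pow_card_eq_one', map_one]
  obtain ⟨ι, _, b, μ, hb⟩ := exists_eigenbasis_of_pow_eq_one hn hg
  have := Fintype.ofFinite ι
  have hpow : ∀ i (k : ℕ), (ρ g ^ k) (b i) = μ i ^ k • b i := fun i k => by
    induction k with
    | zero => simp
    | succ k ih => rw [pow_succ', Module.End.mul_apply, ih, map_smul, hb, smul_smul, pow_succ]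
  have hμ : ∀ i, μ i ^ Nat.card G = 1 := fun i => by
    have h := hpow i (Nat.card G)
    rw [hg, Module.End.one_apply] at h
    exact smul_left_injective ℂ (b.ne_zero i) (by simpa using h.symm)
  have hinv : ∀ i, ρ g⁻¹ (b i) = starRingEnd ℂ (μ i) • b i := fun i => by
    have hne : μ i ≠ 0 := fun h0 => by simpa [h0, hn] using hμ i
    rw [← Complex.inv_eq_conj (Complex.norm_eq_one_of_pow_eq_one (hμ i) hn),
      ρ.inv_apply_eq_iff, map_smul, hb, smul_smul, inv_mul_cancel₀ hne, one_smul]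
  simp only [Representation.character, LinearMap.trace_eq_matrix_trace ℂ b, Matrix.trace,
    Matrix.diag_apply, LinearMap.toMatrix_apply, hb, hinv, map_smul, map_sum]
  simp

theorem Representation.IsIrreducible.isIrrChar {G V : Type} [Group G] [Finite G]
    [AddCommGroup V] [Module ℂ V] [FiniteDimensional ℂ V] (ρ : Representation ℂ G V)
    [ρ.IsIrreducible] : IsIrrChar G ρ.character := by
  have := Fintype.ofFinite G
  have hG : (Nat.card G : ℂ) ≠ 0 := by exact_mod_cast Nat.card_pos.ne'
  have := invertibleOfNonzero hG
  refine ⟨FDRep.of ρ, (FDRep.simple_iff_char_is_norm_one _).mpr ?_, rfl⟩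
  have h := Representation.char_orthonormal ρ ρ
  rw [if_pos ⟨Representation.Equiv.refl ρ⟩, inv_mul_eq_one₀ hG] at h
  exact h.symm

/-- A class function acts as zero on an irreducible representation to whose character it is
orthogonal. -/
theorem Representation.IsIrreducible.sum_smul_eq_zero {G V : Type*} [Group G] [Fintype G]
    [AddCommGroup V] [Module ℂ V] [FiniteDimensional ℂ V] (ρ : Representation ℂ G V)
    [ρ.IsIrreducible] (f : G → ℂ) (hf : ∀ g h, f (h * g * h⁻¹) = f g)
    (h0 : ∑ g, f g * ρ.character g = 0) : ∑ g, f g • ρ g = 0 := by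
  have hcomm : ∀ h, (∑ g, f g • ρ g) * ρ h = ρ h * ∑ g, f g • ρ g := fun h => by
    rw [Finset.sum_mul, Finset.mul_sum]
    refine Fintype.sum_equiv (MulAut.conj h⁻¹).toEquiv _ _ fun g => ?_
    simp only [MulEquiv.toEquiv_eq_coe, EquivLike.coe_coe, MulAut.conj_apply, hf, smul_mul_assoc,
      mul_smul_comm, ← map_mul]
    congr 2
    group
  have hbij : Function.Bijective (algebraMap ℂ (ρ.IntertwiningMap ρ)) :=
    Representation.IsIrreducible.algebraMap_intertwiningMap_bijective_of_isAlgClosed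
  obtain ⟨c, hc⟩ := hbij.2 (LinearMap.intertwiningMap_of_isIntertwiningMap ρ ρ _
      fun h v => LinearMap.congr_fun (hcomm h) v)
  have hc' : c • (1 : Module.End ℂ V) = ∑ g, f g • ρ g :=
    congrArg Representation.IntertwiningMap.toLinearMap hc
  have htr : c * (Module.finrank ℂ V : ℂ) = 0 := by
    rw [← h0]
    simpa [Representation.character] using congrArg (LinearMap.trace ℂ V) hc'
  rw [← hc']
  rcases mul_eq_zero.mp htr with h | h
  · rw [h, zero_smul]
  · have : Subsingleton V := Module.finrank_zero_iff.mp (by exact_mod_cast h)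
    exact Subsingleton.elim _ _

theorem asAlgebraHom_ofModule' {G M : Type*} [Group G] [AddCommGroup M] [Module ℂ M]
    [Module (MonoidAlgebra ℂ G) M] [IsScalarTower ℂ (MonoidAlgebra ℂ G) M] :
    (Representation.ofModule' (k := ℂ) (G := G) M).asAlgebraHom = Algebra.lsmul ℂ ℂ M :=
  (MonoidAlgebra.lift ℂ (M →ₗ[ℂ] M) G).apply_symm_apply _

theorem isIrreducible_ofModule' {G : Type*} (M : Type*) [Group G] [AddCommGroup M] [Module ℂ M]
    [Module (MonoidAlgebra ℂ G) M] [IsScalarTower ℂ (MonoidAlgebra ℂ G) M]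
    [IsSimpleModule (MonoidAlgebra ℂ G) M] :
    (Representation.ofModule' (k := ℂ) (G := G) M).IsIrreducible := by
  let e : (Representation.ofModule' (k := ℂ) (G := G) M).asModule ≃ₗ[MonoidAlgebra ℂ G] M :=
    { (Representation.ofModule' (k := ℂ) (G := G) M).asModuleEquiv.toAddEquiv with
      map_smul' := fun r m =>
        ((Representation.ofModule' M).asModuleEquiv_map_smul r m).trans
          (by rw [asAlgebraHom_ofModule']; rfl) }
  exact (Representation.irreducible_iff_isSimpleModule_asModule _).mpr (IsSimpleModule.congr e)

/-- Irreducible characters are complete: a class function orthogonal to all of them vanishes. -/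
theorem eq_zero_of_forall_isIrrChar {G : Type} [Group G] [Fintype G] (f : G → ℂ)
    (hf : ∀ g h, f (h * g * h⁻¹) = f g) (h0 : ∀ χ, IsIrrChar G χ → ∑ g, f g * χ g = 0) :
    f = 0 := by
  let z : MonoidAlgebra ℂ G := ∑ g, MonoidAlgebra.single g (f g)
  have hsimple : ∀ S : Submodule (MonoidAlgebra ℂ G) (MonoidAlgebra ℂ G),
      IsSimpleModule (MonoidAlgebra ℂ G) S → ∀ s ∈ S, z * s = 0 := fun S hS s hs => by
    have := isIrreducible_ofModule' (G := G) S
    have h := Representation.IsIrreducible.sum_smul_eq_zero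
      (Representation.ofModule' (k := ℂ) (G := G) S) f hf
      (h0 _ (Representation.IsIrreducible.isIrrChar _))
    have hz : (Representation.ofModule' (k := ℂ) (G := G) S).asAlgebraHom z = 0 := by
      rw [← h]
      simp [z, map_sum]
    rw [asAlgebraHom_ofModule'] at hz
    exact congrArg Subtype.val (LinearMap.congr_fun hz ⟨s, hs⟩)
  have hz : z ∈ Module.annihilator (MonoidAlgebra ℂ G) (MonoidAlgebra ℂ G) := by
    rw [← Submodule.annihilator_top, ← IsSemisimpleModule.sSup_simples_eq_top, sSup_eq_iSup',
      Submodule.annihilator_iSup, Submodule.mem_iInf]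
    exact fun S => Submodule.mem_annihilator.mpr fun s hs => hsimple S S.2 s hs
  have hz0 : z = 0 := by simpa using Module.mem_annihilator.mp hz 1
  funext g
  simpa [z, Finsupp.single_apply, Finsupp.finsetSum_apply] using
    congrArg (fun a : MonoidAlgebra ℂ G => a.coeff g) hz0

theorem IsIrrChar.conj_apply {G : Type} [Group G] {χ : G → ℂ} (hχ : IsIrrChar G χ) (g h : G) :
    χ (h * g * h⁻¹) = χ g := by
  obtain ⟨V, -, rfl⟩ := hχ
  exact V.char_conj g h

theorem IsIrrChar.inv_apply {G : Type} [Group G] [Finite G] {χ : G → ℂ} (hχ : IsIrrChar G χ)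
    (g : G) : χ g⁻¹ = starRingEnd ℂ (χ g) := by
  obtain ⟨V, -, rfl⟩ := hχ
  exact Representation.character_inv_eq_conj V.ρ g

theorem IsIrrChar.sum_mul_inv {G : Type} [Group G] [Fintype G] {χ ψ : G → ℂ}
    (hχ : IsIrrChar G χ) (hψ : IsIrrChar G ψ) :
    ∑ g, χ g * ψ g⁻¹ = if χ = ψ then (Nat.card G : ℂ) else 0 := by
  have hG : (Nat.card G : ℂ) ≠ 0 := by exact_mod_cast Nat.card_pos.ne'
  have := invertibleOfNonzero hG
  obtain ⟨V, hV, rfl⟩ := hχ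
  obtain ⟨W, hW, rfl⟩ := hψ
  split_ifs with h
  · rw [← h]
    exact (FDRep.simple_iff_char_is_norm_one V).mp hV
  · have h1 := FDRep.char_orthonormal V W
    rw [if_neg fun ⟨e⟩ => h (FDRep.char_iso e)] at h1
    simpa [hG] using h1

/-- The dual of an irreducible character, twisted by an automorphism, is irreducible. -/
theorem IsIrrChar.inv_twist {G : Type} [Group G] [Finite G] {χ : G → ℂ} (hχ : IsIrrChar G χ)
    (φ : G ≃* G) : IsIrrChar G fun g => χ (φ g⁻¹) := by
  have := Fintype.ofFinite G
  obtain ⟨V, hV, rfl⟩ := hχ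
  let σ : Representation ℂ G V := V.ρ.comp φ.toMonoidHom
  have hσ : (FDRep.of σ.dual).character = fun g => V.character (φ g⁻¹) :=
    funext fun g => Representation.char_dual σ g
  refine ⟨FDRep.of σ.dual, (FDRep.simple_iff_char_is_norm_one _).mpr ?_, hσ.symm⟩
  rw [hσ, ← (FDRep.simple_iff_char_is_norm_one V).mp hV]
  refine Fintype.sum_equiv ((Equiv.inv G).trans φ.toEquiv) _ _ fun g => ?_
  simp

/-- An irreducible character as a function on conjugacy classes. -/
def IsIrrChar.classFun {G : Type} [Group G] {χ : G → ℂ} (hχ : IsIrrChar G χ) :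
    ConjClasses G → ℂ :=
  Quotient.lift χ fun g k (h : IsConj g k) => by
    obtain ⟨c, rfl⟩ := isConj_iff.mp h
    exact (hχ.conj_apply g c).symm

@[simp]
theorem IsIrrChar.classFun_mk {G : Type} [Group G] {χ : G → ℂ} (hχ : IsIrrChar G χ) (g : G) :
    hχ.classFun (ConjClasses.mk g) = χ g := rfl

theorem linearIndependent_classFun (G : Type) [Group G] [Finite G] :
    LinearIndependent ℂ fun χ : {χ : G → ℂ // IsIrrChar G χ} => χ.2.classFun := by
  have := Fintype.ofFinite G
  rw [linearIndependent_iff']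
  intro s c hc χ hχ
  have hG : (Nat.card G : ℂ) ≠ 0 := by exact_mod_cast Nat.card_pos.ne'
  have hpt : ∀ g, ∑ ψ ∈ s, c ψ * ψ.1 g = 0 := fun g => by
    simpa using congrFun hc (ConjClasses.mk g)
  have hsum : ∑ g, (∑ ψ ∈ s, c ψ * ψ.1 g) * χ.1 g⁻¹ = c χ * Nat.card G := by
    simp_rw [Finset.sum_mul, mul_assoc]
    rw [Finset.sum_comm]
    simp_rw [← Finset.mul_sum, fun ψ : {χ : G → ℂ // IsIrrChar G χ} => ψ.2.sum_mul_inv χ.2,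
      ← Subtype.ext_iff]
    simp [hχ]
  simpa [hpt, hG] using hsum.symm

theorem span_classFun_eq_top (G : Type) [Group G] [Finite G] :
    ⊤ ≤ Submodule.span ℂ
      (Set.range fun χ : {χ : G → ℂ // IsIrrChar G χ} => χ.2.classFun) := by
  have := Fintype.ofFinite G
  have : Finite {χ : G → ℂ // IsIrrChar G χ} := (linearIndependent_classFun G).finite
  have := Fintype.ofFinite {χ : G → ℂ // IsIrrChar G χ}
  have hG : (Nat.card G : ℂ) ≠ 0 := by exact_mod_cast Nat.card_pos.ne'
  intro F _
  let c : {χ : G → ℂ // IsIrrChar G χ} → ℂ := fun χ =>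
    (∑ g, F (ConjClasses.mk g) * χ.1 g⁻¹) / Nat.card G
  have key : (fun g => F (ConjClasses.mk g) - ∑ χ, c χ * χ.1 g) = 0 := by
    refine eq_zero_of_forall_isIrrChar _ (fun g h => ?_) fun χ hχ => ?_
    · have hgh : ConjClasses.mk (h * g * h⁻¹) = ConjClasses.mk g :=
        ConjClasses.mk_eq_mk_iff_isConj.mpr (isConj_iff.mpr ⟨h, rfl⟩).symm
      simp only [hgh, fun χ : {χ : G → ℂ // IsIrrChar G χ} => χ.2.conj_apply g h]
    · let ψ : {χ : G → ℂ // IsIrrChar G χ} := ⟨_, hχ.inv_twist (MulEquiv.refl G)⟩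
      have hψ : ∀ g, χ g = ψ.1 g⁻¹ := fun g => by simp [ψ]
      simp_rw [hψ, sub_mul, Finset.sum_sub_distrib, Finset.sum_mul, mul_assoc]
      rw [Finset.sum_comm]
      simp_rw [← Finset.mul_sum, fun χ : {χ : G → ℂ // IsIrrChar G χ} => χ.2.sum_mul_inv ψ.2,
        ← Subtype.ext_iff]
      simp [c]
  have hF : F = ∑ χ, c χ • χ.2.classFun := by
    funext C
    obtain ⟨g, rfl⟩ := ConjClasses.mk_surjective C
    simpa [sub_eq_zero] using congrFun key g
  rw [hF]
  exact Submodule.sum_mem _ fun χ _ =>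
    Submodule.smul_mem _ _ (Submodule.subset_span ⟨χ, rfl⟩)

/-- The irreducible characters as a basis of the space of class functions. -/
noncomputable def irrCharBasis (G : Type) [Group G] [Finite G] :
    Module.Basis {χ : G → ℂ // IsIrrChar G χ} ℂ (ConjClasses G → ℂ) :=
  Module.Basis.mk (linearIndependent_classFun G) (span_classFun_eq_top G)

/-- The map on conjugacy classes induced by `g ↦ φ g⁻¹`. -/
def ConjClasses.invMap {G : Type} [Group G] (φ : G ≃* G) : ConjClasses G → ConjClasses G :=
  Quotient.map (fun g => φ g⁻¹) fun g k (h : IsConj g k) => by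
    obtain ⟨c, rfl⟩ := isConj_iff.mp h
    exact isConj_iff.mpr ⟨φ c, by simp [mul_assoc]⟩

@[simp]
theorem ConjClasses.invMap_mk {G : Type} [Group G] (φ : G ≃* G) (g : G) :
    ConjClasses.invMap φ (ConjClasses.mk g) = ConjClasses.mk (φ g⁻¹) := rfl

/-- **Brauer's permutation lemma** for the anti-automorphism `g ↦ φ g⁻¹`, counting the points
that move. -/
theorem card_moved_irrChar_eq_card_moved_conjClasses {G : Type} [Group G] [Finite G]
    (φ : G ≃* G) :
    Nat.card {χ : {χ : G → ℂ // IsIrrChar G χ} // (fun g => χ.1 (φ g⁻¹)) ≠ χ.1} =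
      Nat.card {C : ConjClasses G // ConjClasses.invMap φ C ≠ C} := by
  let T : (ConjClasses G → ℂ) →ₗ[ℂ] (ConjClasses G → ℂ) :=
    LinearMap.id - LinearMap.funLeft ℂ ℂ (ConjClasses.invMap φ)
  have := Module.Finite.finite_basis (irrCharBasis G)
  rw [← Nat.cast_inj (R := ℂ), ← trace_eq_card_of_repr_self (irrCharBasis G) T,
    ← trace_eq_card_of_repr_self (Pi.basisFun ℂ (ConjClasses G)) T]
  · intro C
    by_cases h : ConjClasses.invMap φ C = C <;>
      simp [T, LinearMap.funLeft_apply, h]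
  · intro χ
    let ψ : {χ : G → ℂ // IsIrrChar G χ} := ⟨_, χ.2.inv_twist φ⟩
    have hT : T (irrCharBasis G χ) = irrCharBasis G χ - irrCharBasis G ψ := by
      funext C
      obtain ⟨g, rfl⟩ := ConjClasses.mk_surjective C
      simp [T, irrCharBasis, LinearMap.funLeft_apply, ψ]
    have hψ : (fun g => χ.1 (φ g⁻¹)) = χ.1 ↔ ψ = χ :=
      (Subtype.ext_iff (a1 := ψ) (a2 := χ)).symm
    simp only [ne_eq, hψ, hT, map_sub, Module.Basis.repr_self, Finsupp.sub_apply,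
      Finsupp.single_apply]
    by_cases h : ψ = χ <;> simp [h]

/-- Conjugation by `x` as an automorphism of a subgroup of index two. -/
def conjOfIndexTwo {Ghat : Type} [Group Ghat] {G : Subgroup Ghat} (h2 : G.index = 2)
    (x : Ghat) : G ≃* G where
  toFun g := ⟨x * g * x⁻¹, conj_mem_of_index_two h2 g.2 x⟩
  invFun g := ⟨x⁻¹ * g * x, by simpa using conj_mem_of_index_two h2 g.2 x⁻¹⟩
  left_inv g := by ext; simp [mul_assoc]
  right_inv g := by ext; simp [mul_assoc]
  map_mul' g h := by ext; simp [mul_assoc]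

theorem cChar_eq {Ghat : Type} [Group Ghat] [Finite Ghat] {G : Subgroup Ghat}
    (h2 : G.index = 2) (x : Ghat) {χ : G → ℂ} (hχ : IsIrrChar G χ) :
    cChar h2 x χ = fun g => χ (conjOfIndexTwo h2 x g⁻¹) := by
  funext g
  rw [map_inv, hχ.inv_apply]
  rfl

theorem bClass_inv_carrier {Ghat : Type} [Group Ghat] {G : Subgroup Ghat}
    (h2 : G.index = 2) (x : Ghat) (C : ConjClasses G) :
    bClass h2 x C.carrier⁻¹ = (ConjClasses.invMap (conjOfIndexTwo h2 x) C).carrier := by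
  let φ := conjOfIndexTwo h2 x
  obtain ⟨g, rfl⟩ := ConjClasses.mk_surjective C
  ext k
  constructor
  · rintro ⟨a, ha, rfl⟩
    have h := congrArg (ConjClasses.invMap φ) (ConjClasses.mem_carrier_iff_mk_eq.mp (Set.mem_inv.mp ha))
    refine ConjClasses.mem_carrier_iff_mk_eq.mpr (Eq.trans ?_ h)
    rw [ConjClasses.invMap_mk, inv_inv]
    rfl
  · intro hk
    obtain ⟨c, hc⟩ := isConj_iff.mp
      (ConjClasses.mk_eq_mk_iff_isConj.mp (ConjClasses.mem_carrier_iff_mk_eq.mp hk))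
    refine ⟨φ.symm k, ?_, φ.apply_symm_apply k⟩
    refine ConjClasses.mem_carrier_iff_mk_eq.mpr (ConjClasses.mk_eq_mk_iff_isConj.mpr
      (isConj_iff.mpr ⟨φ.symm c, φ.injective ?_⟩))
    simp only [map_mul, map_inv, MulEquiv.apply_symm_apply]
    simpa [mul_assoc] using congrArg Inv.inv hc

/-- The number of `χ` with `χ^c ≠ χ` equals the number of classes `K` with `xK⁻¹x⁻¹ ≠ K`. -/
theorem card_c_moved_chars_eq {Ghat : Type} [Group Ghat] [Finite Ghat] (G : Subgroup Ghat)
    (h2 : G.index = 2) (x : Ghat) (hx : x ∉ G) :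
    Set.ncard {χ : ↥G → ℂ | IsIrrChar ↥G χ ∧ cChar h2 x χ ≠ χ} =
      Set.ncard {K : Set ↥G | IsConjClass ↥G K ∧ bClass h2 x K⁻¹ ≠ K} := by
  have hχ : {χ : G → ℂ | IsIrrChar G χ ∧ cChar h2 x χ ≠ χ} =
      Subtype.val '' {χ : {χ : G → ℂ // IsIrrChar G χ} |
        (fun g => χ.1 (conjOfIndexTwo h2 x g⁻¹)) ≠ χ.1} := by
    ext χ
    constructor
    · rintro ⟨hχ, hne⟩
      exact ⟨⟨χ, hχ⟩, by rwa [cChar_eq h2 x hχ] at hne, rfl⟩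
    · rintro ⟨⟨χ, hχ⟩, hne, rfl⟩
      exact ⟨hχ, by rwa [cChar_eq h2 x hχ]⟩
  have hinj : Function.Injective (ConjClasses.carrier : ConjClasses G → Set G) := fun C D h => by
    obtain ⟨g, rfl⟩ := ConjClasses.mk_surjective C
    have hg : g ∈ D.carrier := h ▸ ConjClasses.mem_carrier_mk
    exact ConjClasses.mem_carrier_iff_mk_eq.mp hg
  have hK : {K : Set G | IsConjClass G K ∧ bClass h2 x K⁻¹ ≠ K} =
      ConjClasses.carrier '' {C : ConjClasses G |
        ConjClasses.invMap (conjOfIndexTwo h2 x) C ≠ C} := by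
    ext K
    constructor
    · rintro ⟨⟨g, rfl⟩, hne⟩
      refine ⟨ConjClasses.mk g, fun h => hne ?_, rfl⟩
      exact (bClass_inv_carrier h2 x (ConjClasses.mk g)).trans (congrArg _ h)
    · rintro ⟨C, hC, rfl⟩
      refine ⟨?_, fun h => hC (hinj ((bClass_inv_carrier h2 x C).symm.trans h))⟩
      obtain ⟨g, rfl⟩ := ConjClasses.mk_surjective C
      exact ⟨g, rfl⟩
  rw [hχ, hK, Set.ncard_image_of_injective _ Subtype.val_injective,
    Set.ncard_image_of_injective _ hinj]
  exact card_moved_irrChar_eq_card_moved_conjClasses (conjOfIndexTwo h2 x)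
end

section
/- 4·N_I + N_III + N_V = 2·N̂_ℝ, i.e. 4·#{χ ∈ Irr(G) : F(χ)=1, F♯(χ)=1} + #{χ : F(χ)=1, F♯(χ)=0} + #{χ : F(χ)=0, F♯(χ)=1} = 2·#{ψ ∈ Irr(Ĝ) : FŜ(ψ)=1}. -/
open scoped Classical

open CategoryTheory in
theorem isIrreducible_of_simple {H : Type} [Group H] (V : FDRep ℂ H) [Simple V] :
    Representation.IsIrreducible V.ρ := by
  have hnt : Nontrivial V := by
    by_contra h
    rw [not_nontrivial_iff_subsingleton] at h
    apply Simple.not_isZero V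
    rw [Limits.IsZero.iff_id_eq_zero]
    ext v
    exact Subsingleton.elim (α := V) _ _
  have key : ∀ W : Subrepresentation V.ρ, W = ⊥ ∨ W = ⊤ := by
    intro W
    by_cases hW : W.toSubmodule = ⊥
    · left
      exact Subrepresentation.toSubmodule_injective hW
    · right
      let i : FDRep.of W.toRepresentation ⟶ V :=
        ⟨FGModuleCat.ofHom W.toSubmodule.subtype, fun g => by ext v; rfl⟩
      have hi : Function.Injective (ConcreteCategory.hom i) := Subtype.val_injective
      have : Mono i := ConcreteCategory.mono_of_injective i hi
      have h0 : i ≠ 0 := by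
        intro h
        apply hW
        rw [Submodule.eq_bot_iff]
        intro v hv
        have : (ConcreteCategory.hom i) (⟨v, hv⟩ : W.toSubmodule) = 0 := by rw [h]; rfl
        exact this
      have := isIso_of_mono_of_nonzero h0
      apply Subrepresentation.toSubmodule_injective
      rw [show (⊤ : Subrepresentation V.ρ).toSubmodule = ⊤ from rfl, Submodule.eq_top_iff']
      intro v
      have h2 : (ConcreteCategory.hom i) ((ConcreteCategory.hom (inv i)) v) = v := by
        rw [← ConcreteCategory.comp_apply, IsIso.inv_hom_id]; rfl
      rw [← h2]
      exact Subtype.property (p := (· ∈ W.toSubmodule)) ((ConcreteCategory.hom (inv i)) v)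
  refine { exists_pair_ne := ⟨⊥, ⊤, ?_⟩, eq_bot_or_eq_top := key }
  intro h
  exact bot_ne_top (α := Submodule ℂ V) (congrArg Subrepresentation.toSubmodule h)

/-- The normalized bilinear form on functions for which irreducible characters are orthonormal. -/
noncomputable def charInner {H : Type} [Group H] [Fintype H] (a b : H → ℂ) : ℂ :=
  (Nat.card H : ℂ)⁻¹ * ∑ g : H, a g * b g⁻¹

section Basic

variable {H : Type} [Group H] [Fintype H]

theorem natCard_ne_zero : (Nat.card H : ℂ) ≠ 0 := NeZero.ne _

theorem charInner_add_left (a b c : H → ℂ) :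
    charInner (a + b) c = charInner a c + charInner b c := by
  simp [charInner, add_mul, Finset.sum_add_distrib, mul_add]

theorem charInner_add_right (a b c : H → ℂ) :
    charInner a (b + c) = charInner a b + charInner a c := by
  simp [charInner, Finset.sum_add_distrib, mul_add]

theorem isIrrChar_of_charInner_self {V : Type} [AddCommGroup V] [Module ℂ V]
    [FiniteDimensional ℂ V] (ρ : Representation ℂ H V)
    (h : charInner ρ.character ρ.character = 1) : IsIrrChar H ρ.character := by
  refine ⟨FDRep.of ρ, ?_, rfl⟩
  rw [FDRep.simple_iff_char_is_norm_one]
  rw [charInner, inv_mul_eq_one₀ natCard_ne_zero] at h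
  exact h.symm

theorem charInner_eq_finrank {V W : Type} [AddCommGroup V] [Module ℂ V]
    [FiniteDimensional ℂ V] [AddCommGroup W] [Module ℂ W]
    [FiniteDimensional ℂ W] (ρ : Representation ℂ H V) (σ : Representation ℂ H W) :
    charInner σ.character ρ.character = Module.finrank ℂ (ρ.IntertwiningMap σ) := by
  have := invertibleOfNonzero (natCard_ne_zero (H := H))
  exact Representation.card_inv_mul_sum_char_mul_char_eq_finrank ρ σ

theorem isIrrChar_of_isIrreducible {V : Type} [AddCommGroup V] [Module ℂ V]
    [FiniteDimensional ℂ V] (ρ : Representation ℂ H V) [ρ.IsIrreducible] :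
    IsIrrChar H ρ.character := by
  apply isIrrChar_of_charInner_self
  rw [charInner_eq_finrank]
  simp

omit [Fintype H] in
theorem IsIrrChar.exists_rep {χ : H → ℂ} (h : IsIrrChar H χ) :
    ∃ (V : Type) (_ : AddCommGroup V) (_ : Module ℂ V) (_ : FiniteDimensional ℂ V)
      (ρ : Representation ℂ H V), ρ.IsIrreducible ∧ χ = ρ.character := by
  obtain ⟨V, hV, rfl⟩ := h
  exact ⟨V, inferInstance, inferInstance, inferInstance, V.ρ, isIrreducible_of_simple V, rfl⟩

theorem IsIrrChar.charInner_eq {χ ψ : H → ℂ} (hχ : IsIrrChar H χ) (hψ : IsIrrChar H ψ) :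
    charInner χ ψ = if χ = ψ then 1 else 0 := by
  obtain ⟨V, hV, rfl⟩ := hχ
  obtain ⟨W, hW, rfl⟩ := hψ
  have := invertibleOfNonzero (natCard_ne_zero (H := H))
  have key : ∀ (V W : FDRep ℂ H) [CategoryTheory.Simple V] [CategoryTheory.Simple W],
      charInner V.character W.character = if Nonempty (V ≅ W) then 1 else 0 :=
    fun V W _ _ => FDRep.char_orthonormal V W
  by_cases h : V.character = W.character
  · rw [if_pos h, ← h, key, if_pos ⟨CategoryTheory.Iso.refl V⟩]
  · rw [if_neg h, key, if_neg]
    rintro ⟨i⟩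
    exact h (FDRep.char_iso i)

theorem IsIrrChar.charInner_self {χ : H → ℂ} (hχ : IsIrrChar H χ) : charInner χ χ = 1 := by
  rw [hχ.charInner_eq hχ, if_pos rfl]

omit [Fintype H] in
theorem IsIrrChar.conj {χ : H → ℂ} (h : IsIrrChar H χ) (g k : H) : χ (k * g * k⁻¹) = χ g := by
  obtain ⟨V, hV, rfl⟩ := h
  exact V.char_conj g k

theorem IsIrrChar.comp_mulEquiv {χ : H → ℂ} (h : IsIrrChar H χ) (σ : H ≃* H) :
    IsIrrChar H (fun g => χ (σ g)) := by
  have h1 := h.charInner_self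
  obtain ⟨V, _, _, _, ρ, _, rfl⟩ := h.exists_rep
  refine isIrrChar_of_charInner_self (ρ.comp σ.toMonoidHom : Representation ℂ H V) ?_
  rw [← h1, charInner, charInner]
  congr 1
  refine Fintype.sum_equiv σ.toEquiv _ _ fun g => ?_
  simp [Representation.character]

theorem IsIrrChar.smul_sign {χ : H → ℂ} (h : IsIrrChar H χ) (ε : H →* ℤˣ) :
    IsIrrChar H (fun g => ((ε g : ℤ) : ℂ) * χ g) := by
  have h1 := h.charInner_self
  obtain ⟨V, _, _, _, ρ, _, rfl⟩ := h.exists_rep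
  let ρ' : Representation ℂ H V :=
    { toFun := fun g => ((ε g : ℤ) : ℂ) • ρ g
      map_one' := by simp
      map_mul' := fun a b => by simp [smul_smul, mul_comm] }
  have hρ' : ρ'.character = fun g => ((ε g : ℤ) : ℂ) * ρ.character g := by
    ext g
    simp [Representation.character, ρ']
  rw [← hρ']
  apply isIrrChar_of_charInner_self
  rw [← h1, charInner, charInner, hρ']
  congr 1
  refine Finset.sum_congr rfl fun g _ => ?_
  rcases Int.units_eq_one_or (ε g) with h | h <;> simp [h]

theorem finite_setOf_isIrrChar : {χ : H → ℂ | IsIrrChar H χ}.Finite := by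
  have : LinearIndependent ℂ (fun χ : {χ : H → ℂ | IsIrrChar H χ} => (χ : H → ℂ)) := by
    rw [linearIndependent_iff']
    intro s c hs χ hχ
    have h2 : charInner (∑ ψ ∈ s, c ψ • (ψ : H → ℂ)) (χ : H → ℂ) =
        ∑ ψ ∈ s, c ψ * charInner (ψ : H → ℂ) (χ : H → ℂ) := by
      simp only [charInner, Finset.sum_apply, Pi.smul_apply, smul_eq_mul, Finset.mul_sum,
        Finset.sum_mul]
      rw [Finset.sum_comm]
      exact Finset.sum_congr rfl fun _ _ => Finset.sum_congr rfl fun _ _ => by ring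
    rw [hs, Finset.sum_congr rfl fun ψ _ => by rw [ψ.2.charInner_eq χ.2]] at h2
    simpa [charInner, Subtype.coe_inj, hχ] using h2.symm
  have := this.finite
  exact Set.toFinite _

end Basic

section TwistedIndicator

theorem trace_matrix_transpose_sandwich {n : Type} [Fintype n] (C D : Matrix n n ℂ)
    (Q : Module.End ℂ (Matrix n n ℂ)) (hQ : ∀ M, Q M = D.transpose * M.transpose * C) :
    LinearMap.trace ℂ _ Q = (C * D).trace := by
  rw [LinearMap.trace_eq_matrix_trace ℂ (Matrix.stdBasis ℂ n n)]
  simp only [Matrix.trace, Matrix.diag, LinearMap.toMatrix_apply, Fintype.sum_prod_type]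
  refine Finset.sum_congr rfl fun i _ => ?_
  rw [Matrix.mul_apply]
  refine Finset.sum_congr rfl fun j _ => ?_
  rw [Matrix.stdBasis_eq_single, hQ]
  have h : ∀ N : Matrix n n ℂ, (Matrix.stdBasis ℂ n n).repr N (i, j) = N i j := fun N => rfl
  rw [h]
  simp [Matrix.mul_apply, Matrix.single_apply, ite_and, mul_comm]

theorem trace_eq_of_involutive_line {E : Type} [AddCommGroup E] [Module ℂ E]
    [FiniteDimensional ℂ E] (Q : Module.End ℂ E)
    (hline : ∀ v w, v ∈ LinearMap.range Q → w ∈ LinearMap.range Q → v ≠ 0 → ∃ t : ℂ, w = t • v)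
    (hinv : ∀ v, Q (Q (Q v)) = Q v) :
    LinearMap.trace ℂ E Q = -1 ∨ LinearMap.trace ℂ E Q = 0 ∨ LinearMap.trace ℂ E Q = 1 := by
  by_cases hQ : Q = 0
  · simp [hQ]
  obtain ⟨u, hu⟩ : ∃ u, Q u ≠ 0 := by
    by_contra! h
    exact hQ (LinearMap.ext h)
  obtain ⟨φ, hφ⟩ := Module.Projective.exists_dual_ne_zero ℂ hu
  have hQe : Q = (((φ (Q u))⁻¹ • φ).comp Q).smulRight (Q u) := by
    ext v
    obtain ⟨t, ht⟩ := hline (Q u) (Q v) ⟨u, rfl⟩ ⟨v, rfl⟩ hu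
    simp only [LinearMap.smulRight_apply, LinearMap.comp_apply, LinearMap.smul_apply, ht, map_smul,
      smul_eq_mul]
    congr 1
    field_simp
  obtain ⟨t, ht⟩ := hline (Q u) (Q (Q u)) ⟨u, rfl⟩ ⟨_, rfl⟩ hu
  have htr : LinearMap.trace ℂ E Q = t := by
    rw [hQe, LinearMap.trace_smulRight, LinearMap.comp_apply, ht]
    simp only [map_smul, LinearMap.smul_apply, smul_eq_mul]
    field_simp
  have h2 := hinv u
  rw [ht, map_smul, ht, smul_smul] at h2
  have h3 : t * t = 1 := by
    have : (t * t - 1) • Q u = 0 := by rw [sub_smul, h2, one_smul, sub_self]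
    rcases smul_eq_zero.1 this with h | h
    · exact sub_eq_zero.1 h
    · exact absurd h hu
  rw [htr]
  rcases mul_self_eq_one_iff.1 h3 with h | h <;> simp [h]

variable {H : Type} [Group H] [Fintype H]

omit [Fintype H] in
/-- A form on an irreducible representation that is invariant up to a twist by an automorphism is
zero or nondegenerate. -/
theorem twisted_form_eq_zero {V : Type} [AddCommGroup V] [Module ℂ V]
    {n : Type} [Fintype n] [DecidableEq n] (b : Module.Basis n ℂ V)
    (ρ : Representation ℂ H V) [ρ.IsIrreducible] (σ : H ≃* H)
    (M : Matrix n n ℂ)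
    (hM : ∀ g, (LinearMap.toMatrixAlgEquiv b (ρ g)).transpose * M *
      LinearMap.toMatrixAlgEquiv b (ρ (σ g)) = M)
    {v : n → ℂ} (hv : v ≠ 0) (hMv : M.mulVec v = 0) : M = 0 := by
  have hM' : ∀ g, M * LinearMap.toMatrixAlgEquiv b (ρ (σ g)) =
      (LinearMap.toMatrixAlgEquiv b (ρ g⁻¹)).transpose * M := by
    intro g
    conv_rhs => rw [← hM g]
    rw [← mul_assoc, ← mul_assoc, ← Matrix.transpose_mul, ← map_mul, ← map_mul, mul_inv_cancel]
    simp
  have hrep : ∀ g w, (b.repr (ρ g w) : n → ℂ) =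
      (LinearMap.toMatrixAlgEquiv b (ρ g)).mulVec (b.repr w) := by
    intro g w
    exact (LinearMap.toMatrix_mulVec_repr b b (ρ g) w).symm
  let K : Subrepresentation ρ :=
    { toSubmodule := LinearMap.ker (M.mulVecLin ∘ₗ b.equivFun.toLinearMap)
      apply_mem_toSubmodule := by
        intro g w hw
        obtain ⟨g, rfl⟩ := σ.surjective g
        simp only [LinearMap.mem_ker, LinearMap.comp_apply, LinearEquiv.coe_coe,
          Matrix.mulVecLin_apply, Module.Basis.equivFun_apply] at hw ⊢
        rw [hrep, Matrix.mulVec_mulVec, hM', ← Matrix.mulVec_mulVec, hw, Matrix.mulVec_zero] }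
  have hmem : ∀ w, w ∈ K.toSubmodule ↔ M.mulVec (b.equivFun w) = 0 := fun w => Iff.rfl
  rcases eq_bot_or_eq_top K with h | h
  · exfalso
    have h1 : b.equivFun.symm v ∈ K.toSubmodule := by
      rwa [hmem, LinearEquiv.apply_symm_apply]
    rw [h] at h1
    have h2 : b.equivFun.symm v = 0 := h1
    exact hv (b.equivFun.symm.map_eq_zero_iff.1 h2)
  · have : ∀ w, M.mulVec w = 0 := by
      intro w
      have h1 : b.equivFun.symm w ∈ K.toSubmodule := by
        rw [h]; exact Submodule.mem_top
      rwa [hmem, LinearEquiv.apply_symm_apply] at h1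
    exact Matrix.mulVec_injective (funext fun w => by simp [this])

theorem twisted_indicator_of_matrix {n : Type} [Fintype n] (R : H → Matrix n n ℂ)
    (hR : ∀ g k, R (g * k) = R g * R k) (σ : H ≃* H) (z : H)
    (hσ : ∀ g, σ (σ g) = z * g * z⁻¹) (hz : σ z = z)
    (hnd : ∀ M, (∀ g, (R g).transpose * M * R (σ g) = M) →
      ∀ v : n → ℂ, v ≠ 0 → M.mulVec v = 0 → M = 0) :
    (Nat.card H : ℂ)⁻¹ * ∑ g, (R (g * σ g * z)).trace = -1 ∨
    (Nat.card H : ℂ)⁻¹ * ∑ g, (R (g * σ g * z)).trace = 0 ∨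
    (Nat.card H : ℂ)⁻¹ * ∑ g, (R (g * σ g * z)).trace = 1 := by
  let Q₀ : H → Module.End ℂ (Matrix n n ℂ) := fun g =>
    { toFun := fun M => (R (σ g * z)).transpose * M.transpose * R g
      map_add' := fun M N => by simp [mul_add, add_mul]
      map_smul' := fun c M => by simp }
  have hQ₀ : ∀ g M, Q₀ g M = (R (σ g * z)).transpose * M.transpose * R g := fun _ _ => rfl
  let Q : Module.End ℂ (Matrix n n ℂ) := (Nat.card H : ℂ)⁻¹ • ∑ g, Q₀ g
  have hQ : ∀ M, Q M = (Nat.card H : ℂ)⁻¹ • ∑ g, Q₀ g M := fun M => by simp [Q]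
  have htr : (Nat.card H : ℂ)⁻¹ * ∑ g, (R (g * σ g * z)).trace = LinearMap.trace ℂ _ Q := by
    simp only [Q, map_smul, smul_eq_mul, map_sum]
    congr 1
    refine Finset.sum_congr rfl fun g _ => ?_
    rw [trace_matrix_transpose_sandwich _ _ _ (hQ₀ g), ← hR, mul_assoc]
  have hinvQ : ∀ M k, (R k).transpose * Q M * R (σ k) = Q M := by
    intro M k
    rw [hQ, Matrix.mul_smul, Matrix.smul_mul, Finset.mul_sum, Finset.sum_mul]
    refine congrArg _ ?_
    refine Fintype.sum_equiv (Equiv.mulRight (σ k)) _ _ fun g => ?_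
    simp only [hQ₀, Equiv.coe_mulRight]
    have : σ (g * σ k) * z = σ g * z * k := by rw [map_mul, hσ]; group
    rw [this, hR g, hR _ k, Matrix.transpose_mul]
    simp only [mul_assoc]
  have hQW : ∀ M, (∀ k, (R k).transpose * M * R (σ k) = M) →
      Q M = (R z).transpose * M.transpose := by
    intro M hM
    have : ∀ g, Q₀ g M = (R z).transpose * M.transpose := by
      intro g
      rw [hQ₀]
      conv_rhs => rw [← hM g]
      rw [hR, Matrix.transpose_mul, Matrix.transpose_mul, Matrix.transpose_mul,
        Matrix.transpose_transpose]
      simp only [mul_assoc]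
    rw [hQ]
    simp only [this, Finset.sum_const, Finset.card_univ, ← Nat.card_eq_fintype_card]
    rw [← Nat.cast_smul_eq_nsmul ℂ, smul_smul, inv_mul_cancel₀ natCard_ne_zero, one_smul]
  rw [htr]
  apply trace_eq_of_involutive_line
  · rintro _ _ ⟨M, rfl⟩ ⟨N, rfl⟩ hM
    have : Nonempty n := by
      by_contra hn
      rw [not_nonempty_iff] at hn
      exact hM (Subsingleton.elim _ _)
    have hdet : IsUnit (Q M).det := by
      rw [isUnit_iff_ne_zero]
      intro h0
      obtain ⟨v, hv, hv0⟩ := Matrix.exists_mulVec_eq_zero_iff.2 h0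
      exact hM (hnd (Q M) (hinvQ M) v hv hv0)
    obtain ⟨t, ht⟩ := Module.End.exists_eigenvalue (Matrix.toLin' ((Q M)⁻¹ * Q N))
    obtain ⟨v, hv⟩ := ht.exists_hasEigenvector
    refine ⟨t, sub_eq_zero.1 (hnd _ (fun g => ?_) v hv.2 ?_)⟩
    · rw [mul_sub, sub_mul, Matrix.mul_smul, Matrix.smul_mul]
      exact congrArg₂ _ (hinvQ N g) (congrArg _ (hinvQ M g))
    · have h1 := hv.apply_eq_smul
      rw [Matrix.toLin'_apply] at h1
      have h2 := congrArg (Q M).mulVec h1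
      rw [Matrix.mulVec_mulVec, ← mul_assoc, Matrix.mul_nonsing_inv _ hdet, one_mul,
        Matrix.mulVec_smul] at h2
      rw [Matrix.sub_mulVec, h2, Matrix.smul_mulVec, sub_self]
  · intro M
    rw [hQW (Q (Q M)) (hinvQ _), hQW (Q M) (hinvQ _), Matrix.transpose_mul,
      Matrix.transpose_transpose, Matrix.transpose_transpose]
    have := hinvQ M z
    rwa [hz, mul_assoc] at this

/-- The Frobenius–Schur indicator of an irreducible character, twisted by an automorphism `σ` with
`σ² = Ad z` and `σ z = z`, is `-1`, `0` or `1`. -/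
theorem IsIrrChar.twisted_indicator {χ : H → ℂ} (h : IsIrrChar H χ) (σ : H ≃* H) (z : H)
    (hσ : ∀ g, σ (σ g) = z * g * z⁻¹) (hz : σ z = z) :
    (Nat.card H : ℂ)⁻¹ * ∑ g, χ (g * σ g * z) = -1 ∨
    (Nat.card H : ℂ)⁻¹ * ∑ g, χ (g * σ g * z) = 0 ∨
    (Nat.card H : ℂ)⁻¹ * ∑ g, χ (g * σ g * z) = 1 := by
  obtain ⟨V, _, _, _, ρ, _, rfl⟩ := h.exists_rep
  let b := Module.finBasis ℂ V
  have hχ : ∀ g, ρ.character g = (LinearMap.toMatrixAlgEquiv b (ρ g)).trace := fun g =>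
    LinearMap.trace_eq_matrix_trace ℂ b (ρ g)
  simp only [hχ]
  exact twisted_indicator_of_matrix (fun g => LinearMap.toMatrixAlgEquiv b (ρ g))
    (fun g k => by simp) σ z hσ hz
    fun M hM v hv hv0 => twisted_form_eq_zero b ρ σ M hM hv hv0

end TwistedIndicator

section Clifford

/-- Every nonzero finite-dimensional representation contains an irreducible one. -/
theorem exists_irreducible_subrepresentation {H V : Type} [Group H] [AddCommGroup V] [Module ℂ V]
    [FiniteDimensional ℂ V] (ρ : Representation ℂ H V) [Nontrivial V] :
    ∃ W : Subrepresentation ρ, W.toSubmodule ≠ ⊥ ∧ W.toRepresentation.IsIrreducible := by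
  let S : Set (Submodule ℂ V) := {W | W ≠ ⊥ ∧ ∀ g, ∀ v ∈ W, ρ g v ∈ W}
  have hS : S.Nonempty := ⟨⊤, top_ne_bot, fun _ _ _ => Submodule.mem_top⟩
  obtain ⟨W, ⟨hW0, hWs⟩, hmin⟩ := WellFounded.has_min (wellFounded_lt (α := Submodule ℂ V)) S hS
  refine ⟨⟨W, hWs⟩, hW0, ?_⟩
  refine { exists_pair_ne := ⟨⊥, ⊤, ?_⟩, eq_bot_or_eq_top := ?_ }
  · intro h
    have h1 : (⊥ : Submodule ℂ W) = ⊤ := congrArg Subrepresentation.toSubmodule h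
    have := Submodule.nontrivial_iff_ne_bot.2 hW0
    exact bot_ne_top h1
  · intro U
    by_cases hU : U.toSubmodule = ⊥
    · exact Or.inl (Subrepresentation.toSubmodule_injective hU)
    · right
      apply Subrepresentation.toSubmodule_injective
      change U.toSubmodule = ⊤
      have hle : U.toSubmodule.map W.subtype ≤ W := Submodule.map_subtype_le _ _
      have hmem : U.toSubmodule.map W.subtype ∈ S := by
        refine ⟨?_, ?_⟩
        · intro h
          exact hU (Submodule.map_injective_of_injective W.subtype_injective
            (h.trans (Submodule.map_bot _).symm))
        · rintro g _ ⟨v, hv, rfl⟩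
          exact ⟨_, U.apply_mem_toSubmodule g hv, rfl⟩
      have heq : U.toSubmodule.map W.subtype = W :=
        hle.eq_of_not_lt (hmin _ hmem)
      apply Submodule.map_injective_of_injective W.subtype_injective
      rw [heq, Submodule.map_subtype_top]

variable {Ghat : Type} [Group Ghat] {G : Subgroup Ghat}

/-- Clifford's theorem for a subgroup of index two, with the constituents not yet known to be
distinct. -/
theorem clifford_index_two [Fintype Ghat] (h2 : G.index = 2) {x : Ghat} (hx : x ∉ G)
    {ψ : Ghat → ℂ} (hψ : IsIrrChar Ghat ψ) :
    IsIrrChar G (fun g => ψ g) ∨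
      ∃ χ, IsIrrChar G χ ∧ (fun g : G => ψ g) = χ + bChar h2 x χ := by
  obtain ⟨V, _, _, _, ρ, hρ, rfl⟩ := hψ.exists_rep
  have hnt : Nontrivial V := by
    by_contra h
    rw [not_nontrivial_iff_subsingleton] at h
    exact bot_ne_top (α := Subrepresentation ρ)
      (Subrepresentation.toSubmodule_injective (Subsingleton.elim _ _))
  let ρG : Representation ℂ G V := ρ.comp G.subtype
  have hρG : ∀ (g : Ghat) (hg : g ∈ G), ρG ⟨g, hg⟩ = ρ g := fun _ _ => rfl
  have hmul : ∀ a b v, ρ a (ρ b v) = ρ (a * b) v := fun a b v => by rw [map_mul]; rfl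
  obtain ⟨W, hW0, hWirr⟩ := exists_irreducible_subrepresentation ρG
  have hWs : ∀ g ∈ G, ∀ v ∈ W.toSubmodule, ρ g v ∈ W.toSubmodule := fun g hg v hv =>
    W.apply_mem_toSubmodule ⟨g, hg⟩ hv
  have hxi : x⁻¹ ∉ G := by rwa [inv_mem_iff]
  have hstab : ∀ (U : Submodule ℂ V), (∀ g, ∀ v ∈ U, ρ g v ∈ U) → U = ⊥ ∨ U = ⊤ := by
    intro U hU
    rcases eq_bot_or_eq_top (⟨U, hU⟩ : Subrepresentation ρ) with h | h
    · exact Or.inl (congrArg Subrepresentation.toSubmodule h)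
    · exact Or.inr (congrArg Subrepresentation.toSubmodule h)
  -- the translate of `W` by `x⁻¹`
  let X := W.toSubmodule.map (ρ x⁻¹)
  have hWX : ∀ g ∉ G, ∀ v ∈ W.toSubmodule, ρ g v ∈ X := by
    intro g hg v hv
    refine ⟨ρ (x * g) v, hWs _ ?_ _ hv, ?_⟩
    · rw [Subgroup.mul_mem_iff_of_index_two h2]; simp [hx, hg]
    · rw [hmul]; simp
  have hXW : ∀ g ∉ G, ∀ v ∈ X, ρ g v ∈ W.toSubmodule := by
    rintro g hg _ ⟨v, hv, rfl⟩
    rw [hmul]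
    apply hWs _ _ _ hv
    rw [Subgroup.mul_mem_iff_of_index_two h2]; simp [hx, hg]
  have hXs : ∀ g ∈ G, ∀ v ∈ X, ρ g v ∈ X := by
    rintro g hg _ ⟨v, hv, rfl⟩
    rw [hmul]
    apply hWX _ _ _ hv
    rw [Subgroup.mul_mem_iff_of_index_two h2]; simp [hx, hg]
  have hsup : W.toSubmodule ⊔ X = ⊤ := by
    refine (hstab _ ?_).resolve_left fun h => hW0 (eq_bot_mono le_sup_left h)
    intro g v hv
    obtain ⟨a, ha, c, hc, rfl⟩ := Submodule.mem_sup.1 hv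
    rw [map_add]
    by_cases hg : g ∈ G
    · exact Submodule.add_mem_sup (hWs g hg a ha) (hXs g hg c hc)
    · rw [add_comm]
      exact Submodule.add_mem_sup (hXW g hg c hc) (hWX g hg a ha)
  have hinf := hstab (W.toSubmodule ⊓ X) (by
    rintro g v ⟨hv, hv'⟩
    by_cases hg : g ∈ G
    · exact ⟨hWs g hg v hv, hXs g hg v hv'⟩
    · exact ⟨hXW g hg v hv', hWX g hg v hv⟩)
  rcases hinf with hinf | hinf
  · right
    refine ⟨W.toRepresentation.character, isIrrChar_of_isIrreducible _, ?_⟩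
    let f : W.toSubmodule × W.toSubmodule →ₗ[ℂ] V :=
      W.toSubmodule.subtype.coprod (ρ x⁻¹ ∘ₗ W.toSubmodule.subtype)
    have hf : ∀ a c, f (a, c) = a + ρ x⁻¹ c := fun _ _ => rfl
    have hinj : Function.Injective f := by
      rw [← LinearMap.ker_eq_bot, LinearMap.ker_eq_bot']
      rintro ⟨a, c⟩ hac
      rw [hf] at hac
      have ha : (a : V) ∈ W.toSubmodule ⊓ X := by
        refine ⟨a.2, ?_⟩
        rw [eq_neg_of_add_eq_zero_left hac]
        exact neg_mem ⟨c, c.2, rfl⟩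
      rw [hinf, Submodule.mem_bot] at ha
      rw [ha, zero_add] at hac
      have hc : (c : V) = 0 := by
        have := congrArg (ρ x) hac
        rw [hmul] at this
        simpa using this
      exact Prod.ext (Subtype.ext ha) (Subtype.ext hc)
    have hsurj : Function.Surjective f := by
      intro v
      obtain ⟨a, ha, _, ⟨c, hc, rfl⟩, rfl⟩ :=
        Submodule.mem_sup.1 (hsup ▸ Submodule.mem_top : v ∈ W.toSubmodule ⊔ X)
      exact ⟨(⟨a, ha⟩, ⟨c, hc⟩), rfl⟩
    let e := LinearEquiv.ofBijective f ⟨hinj, hsurj⟩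
    funext g
    have hconj : e.conj ((W.toRepresentation g).prodMap
        (W.toRepresentation ⟨x * g * x⁻¹, conj_mem_of_index_two h2 g.2 x⟩)) = ρ g := by
      ext v
      obtain ⟨⟨a, c⟩, rfl⟩ := e.surjective v
      rw [LinearEquiv.conj_apply_apply, e.symm_apply_apply]
      change f _ = ρ g (f _)
      rw [LinearMap.prodMap_apply, hf, hf, map_add]
      change ρ g a + ρ x⁻¹ (ρ (x * g * x⁻¹) c) = _
      rw [hmul, hmul]
      congr 3
      group
    change LinearMap.trace ℂ V (ρ g) = _
    rw [← hconj, LinearMap.trace_conj', LinearMap.trace_prodMap']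
    rfl
  · left
    have htop : W.toSubmodule = ⊤ := top_le_iff.1 (hinf ▸ inf_le_left)
    have heq : W.toRepresentation.character = fun g : G => ρ.character g := by
      funext g
      change LinearMap.trace ℂ _ (W.toRepresentation g) = LinearMap.trace ℂ V (ρ g)
      rw [← LinearMap.trace_conj' _ (LinearEquiv.ofTop _ htop)]
      rfl
    rw [← heq]
    exact isIrrChar_of_isIrreducible _

theorem exists_isIrrChar_of_eval [Fintype Ghat] {V I : Type} [AddCommGroup V] [Module ℂ V]
    [FiniteDimensional ℂ V] [AddCommGroup I] [Module ℂ I] [FiniteDimensional ℂ I] [Nontrivial I]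
    (ρ : Representation ℂ G V) (τ : Representation ℂ Ghat I) (ev : I →ₗ[ℂ] V)
    (hev : ∀ (g : G) u, ev (τ g u) = ρ g (ev u)) (hev0 : ∀ u, (∀ k, ev (τ k u) = 0) → u = 0) :
    ∃ ψ, IsIrrChar Ghat ψ ∧ charInner ρ.character (fun g : G => ψ g) ≠ 0 := by
  obtain ⟨U, hU0, hUirr⟩ := exists_irreducible_subrepresentation τ
  refine ⟨U.toRepresentation.character, isIrrChar_of_isIrreducible _, ?_⟩
  let σ : Representation ℂ G U.toSubmodule := U.toRepresentation.comp G.subtype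
  let T : σ.IntertwiningMap ρ :=
    ⟨ev ∘ₗ U.toSubmodule.subtype, fun g => LinearMap.ext fun u => hev g u⟩
  have hT0 : T ≠ 0 := by
    obtain ⟨u, hu, hu0⟩ := Submodule.exists_mem_ne_zero_of_ne_bot hU0
    intro h
    refine hu0 (hev0 u fun k => ?_)
    have h1 : T (U.toRepresentation k ⟨u, hu⟩) = 0 := by rw [h]; rfl
    exact h1
  have hσ : (fun g : G => U.toRepresentation.character g) = σ.character := rfl
  rw [hσ, charInner_eq_finrank, Nat.cast_ne_zero]
  have : Nontrivial (σ.IntertwiningMap ρ) := ⟨T, 0, hT0⟩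
  exact Module.finrank_pos.ne'

/-- Every irreducible character of a subgroup is contained in the restriction of an irreducible
character of the group. -/
theorem exists_isIrrChar_above [Fintype Ghat] {χ : G → ℂ} (hχ : IsIrrChar G χ) :
    ∃ ψ, IsIrrChar Ghat ψ ∧ charInner χ (fun g : G => ψ g) ≠ 0 := by
  obtain ⟨V, _, _, _, ρ, hρ, rfl⟩ := hχ.exists_rep
  obtain ⟨v, hv⟩ : ∃ v : V, v ≠ 0 := by
    by_contra! h
    have : Subsingleton V := ⟨fun a b => by rw [h a, h b]⟩
    exact bot_ne_top (α := Subrepresentation ρ)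
      (Subrepresentation.toSubmodule_injective (Subsingleton.elim _ _))
  let I := Representation.coindV G.subtype ρ
  let f : I := ⟨fun h => if hh : h ∈ G then ρ ⟨h, hh⟩ v else 0, by
    rw [Representation.mem_coindV]
    intro g h
    have : (G.subtype g * h ∈ G) ↔ h ∈ G := Subgroup.mul_mem_cancel_left _ g.2
    by_cases hh : h ∈ G
    · rw [dif_pos (this.2 hh), dif_pos hh, ← Module.End.mul_apply, ← map_mul]
      rfl
    · rw [dif_neg (mt this.1 hh), dif_neg hh, map_zero]⟩
  have hf : f.1 1 = v := by
    change (if hh : (1 : Ghat) ∈ G then ρ ⟨1, hh⟩ v else 0) = v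
    rw [dif_pos G.one_mem]
    exact congrFun (congrArg DFunLike.coe (map_one ρ)) v
  have : Nontrivial I := ⟨f, 0, fun h => hv (by rw [← hf, h]; rfl)⟩
  refine exists_isIrrChar_of_eval ρ (Representation.coind G.subtype ρ)
    (LinearMap.proj 1 ∘ₗ I.subtype) (fun g u => ?_) (fun u hu => ?_)
  · have h1 := u.2 g 1
    change u.1 (1 * (g : Ghat)) = ρ g (u.1 1)
    rw [← h1, one_mul, mul_one]
    rfl
  · apply Subtype.ext
    funext k
    have h1 : u.1 (1 * k) = 0 := hu k
    rwa [one_mul] at h1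

end Clifford

section IndexTwo

variable {Ghat : Type} [Group Ghat] {G : Subgroup Ghat}

/-- The sign character of a group with kernel a given subgroup of index two. -/
noncomputable def signOfIndexTwo (h2 : G.index = 2) : Ghat →* ℤˣ where
  toFun h := if h ∈ G then 1 else -1
  map_one' := if_pos G.one_mem
  map_mul' a b := by
    rw [Subgroup.mul_mem_iff_of_index_two h2]
    by_cases ha : a ∈ G <;> by_cases hb : b ∈ G <;> simp [ha, hb]

theorem signOfIndexTwo_of_mem (h2 : G.index = 2) {h : Ghat} (hh : h ∈ G) :
    signOfIndexTwo h2 h = 1 := if_pos hh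

theorem signOfIndexTwo_of_notMem (h2 : G.index = 2) {h : Ghat} (hh : h ∉ G) :
    signOfIndexTwo h2 h = -1 := if_neg hh

/-- The twist of a function on `Ghat` by the sign character. -/
noncomputable def signTwist (h2 : G.index = 2) (ψ : Ghat → ℂ) : Ghat → ℂ :=
  fun g => ((signOfIndexTwo h2 g : ℤ) : ℂ) * ψ g

/-- Restriction of functions to a subgroup. -/
def resChar (G : Subgroup Ghat) (ψ : Ghat → ℂ) : G → ℂ := fun g => ψ g

theorem resChar_signTwist (h2 : G.index = 2) (ψ : Ghat → ℂ) :
    resChar G (signTwist h2 ψ) = resChar G ψ := by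
  funext g
  simp [resChar, signTwist, signOfIndexTwo_of_mem h2 g.2]

/-- Conjugation by `x` as an automorphism of a subgroup of index two. -/
noncomputable def conjEquiv (h2 : G.index = 2) (x : Ghat) : G ≃* G :=
  have := Subgroup.normal_of_index_eq_two h2
  MulAut.conjNormal x

@[simp]
theorem coe_conjEquiv (h2 : G.index = 2) (x : Ghat) (g : G) :
    (conjEquiv h2 x g : Ghat) = x * g * x⁻¹ :=
  have := Subgroup.normal_of_index_eq_two h2
  MulAut.conjNormal_apply x g

theorem conjEquiv_apply (h2 : G.index = 2) (x : Ghat) (g : G) :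
    conjEquiv h2 x g = ⟨x * g * x⁻¹, conj_mem_of_index_two h2 g.2 x⟩ :=
  Subtype.ext (coe_conjEquiv h2 x g)

theorem bChar_eq (h2 : G.index = 2) (x : Ghat) (χ : G → ℂ) :
    bChar h2 x χ = fun g => χ (conjEquiv h2 x g) := by
  funext g
  rw [conjEquiv_apply]
  rfl

theorem exists_notMem_of_index_two (h2 : G.index = 2) : ∃ x, x ∉ G := by
  by_contra! h
  rw [(Subgroup.eq_top_iff' G).2 h, Subgroup.index_top] at h2
  norm_num at h2

theorem natCard_eq_two_mul (h2 : G.index = 2) : Nat.card Ghat = 2 * Nat.card G := by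
  rw [← h2, mul_comm, Subgroup.card_mul_index]

variable [Fintype Ghat]

theorem sum_notMem_eq (h2 : G.index = 2) {x : Ghat} (hx : x ∉ G) (f : {h : Ghat // h ∉ G} → ℂ) :
    ∑ h, f h = ∑ g : G, f ⟨g * x, by
      rw [Subgroup.mul_mem_iff_of_index_two h2]; simp [hx]⟩ := by
  have hmem : ∀ h : {h : Ghat // h ∉ G}, (h : Ghat) * x⁻¹ ∈ G := by
    intro h
    rw [Subgroup.mul_mem_iff_of_index_two h2, inv_mem_iff]
    simp [hx, h.2]
  refine (Fintype.sum_equiv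
    ({ toFun := fun g => ⟨g * x, by
        rw [Subgroup.mul_mem_iff_of_index_two h2]; simp [hx]⟩
       invFun := fun h => ⟨h * x⁻¹, hmem h⟩
       left_inv := fun g => by simp
       right_inv := fun h => by simp } : G ≃ {h : Ghat // h ∉ G}) _ _ fun g => rfl).symm

theorem charInner_resChar (h2 : G.index = 2) (ψ φ : Ghat → ℂ) :
    charInner (resChar G ψ) (resChar G φ) =
      charInner ψ φ + charInner ψ (signTwist h2 φ) := by
  have h1 : ∑ g : G, ψ g * φ (g : Ghat)⁻¹ = ∑ g : {h // h ∈ G}, ψ g * φ (g : Ghat)⁻¹ :=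
    Fintype.sum_equiv (Equiv.refl _) _ _ fun _ => rfl
  have e1 := Fintype.sum_subtype_add_sum_subtype (fun h => h ∈ G) (fun h => ψ h * φ h⁻¹)
  have e2 := Fintype.sum_subtype_add_sum_subtype (fun h => h ∈ G)
    (fun h => ψ h * signTwist h2 φ h⁻¹)
  have h3 : ∑ g : {h // h ∈ G}, ψ g * signTwist h2 φ (g : Ghat)⁻¹ =
      ∑ g : {h // h ∈ G}, ψ g * φ (g : Ghat)⁻¹ :=
    Finset.sum_congr rfl fun g _ => by
      simp [signTwist, signOfIndexTwo_of_mem h2 (inv_mem g.2)]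
  have h4 : ∑ g : {h // h ∉ G}, ψ g * signTwist h2 φ (g : Ghat)⁻¹ =
      -∑ g : {h // h ∉ G}, ψ g * φ (g : Ghat)⁻¹ := by
    rw [← Finset.sum_neg_distrib]
    refine Finset.sum_congr rfl fun g _ => ?_
    have : (g : Ghat)⁻¹ ∉ G := by rw [inv_mem_iff]; exact g.2
    simp [signTwist, signOfIndexTwo_of_notMem h2 this]
  rw [h3, h4] at e2
  have hc : (Nat.card Ghat : ℂ) = 2 * Nat.card G := by
    rw [natCard_eq_two_mul h2]; push_cast; rfl
  have hG : (Nat.card G : ℂ) ≠ 0 := natCard_ne_zero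
  simp only [charInner, resChar, Subgroup.coe_inv]
  rw [← e1, ← e2, h1, hc]
  field_simp
  ring

theorem IsIrrChar.signTwist {ψ : Ghat → ℂ} (hψ : IsIrrChar Ghat ψ) (h2 : G.index = 2) :
    IsIrrChar Ghat (signTwist h2 ψ) := hψ.smul_sign _

theorem IsIrrChar.bChar {χ : G → ℂ} (hχ : IsIrrChar G χ) (h2 : G.index = 2) (x : Ghat) :
    IsIrrChar G (bChar h2 x χ) := by
  rw [bChar_eq]
  exact hχ.comp_mulEquiv _

omit [Fintype Ghat] in
theorem IsIrrChar.bChar_bChar {χ : G → ℂ} (hχ : IsIrrChar G χ) (h2 : G.index = 2) (x : Ghat) :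
    _root_.bChar h2 x (_root_.bChar h2 x χ) = χ := by
  funext g
  rw [bChar_eq, bChar_eq,
    ← hχ.conj g ⟨x ^ 2, Subgroup.sq_mem_of_index_two h2 x⟩]
  refine congrArg χ (Subtype.ext ?_)
  simp only [coe_conjEquiv, Subgroup.coe_mul, Subgroup.coe_inv, pow_two]
  group

omit [Fintype Ghat] in
theorem IsIrrChar.bChar_resChar {ψ : Ghat → ℂ} (hψ : IsIrrChar Ghat ψ) (h2 : G.index = 2)
    (x : Ghat) : _root_.bChar h2 x (resChar G ψ) = resChar G ψ :=
  funext fun g => hψ.conj g x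

theorem IsIrrChar.charInner_add_bChar {χ : G → ℂ} (hχ : IsIrrChar G χ) (h2 : G.index = 2)
    (x : Ghat) : charInner (χ + _root_.bChar h2 x χ) (χ + _root_.bChar h2 x χ) =
      if _root_.bChar h2 x χ = χ then 4 else 2 := by
  simp only [charInner_add_left, charInner_add_right, hχ.charInner_eq (hχ.bChar h2 x),
    (hχ.bChar h2 x).charInner_eq hχ, hχ.charInner_self, (hχ.bChar h2 x).charInner_self]
  by_cases h : _root_.bChar h2 x χ = χ
  · rw [if_pos h.symm, if_pos h, if_pos h]; norm_num
  · rw [if_neg (Ne.symm h), if_neg h, if_neg h]; norm_num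

/-- Clifford's theorem for a subgroup of index two. -/
theorem IsIrrChar.resChar_cases (h2 : G.index = 2) {x : Ghat} (hx : x ∉ G)
    {ψ : Ghat → ℂ} (hψ : IsIrrChar Ghat ψ) :
    IsIrrChar G (resChar G ψ) ∨
      ∃ χ, IsIrrChar G χ ∧ _root_.bChar h2 x χ ≠ χ ∧
        resChar G ψ = χ + _root_.bChar h2 x χ ∧ ∀ h ∉ G, ψ h = 0 := by
  rcases clifford_index_two h2 hx hψ with h | ⟨χ, hχ, h⟩
  · exact Or.inl h
  right
  have hr : resChar G ψ = χ + _root_.bChar h2 x χ := h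
  have h1 := charInner_resChar h2 ψ ψ
  rw [hr, hχ.charInner_add_bChar, hψ.charInner_self,
    hψ.charInner_eq (hψ.signTwist h2)] at h1
  have hne : _root_.bChar h2 x χ ≠ χ := by
    intro hb
    rw [if_pos hb] at h1
    split_ifs at h1 <;> norm_num at h1
  rw [if_neg hne] at h1
  refine ⟨χ, hχ, hne, hr, fun k hk => ?_⟩
  have hs : ψ = _root_.signTwist h2 ψ := by
    by_contra hs
    rw [if_neg hs] at h1
    norm_num at h1
  have h3 := congrFun hs k
  simp only [_root_.signTwist, signOfIndexTwo_of_notMem h2 hk] at h3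
  push_cast at h3
  linear_combination h3 / 2

theorem IsIrrChar.exists_above_cases {χ : G → ℂ} (hχ : IsIrrChar G χ) (h2 : G.index = 2)
    {x : Ghat} (hx : x ∉ G) :
    (_root_.bChar h2 x χ = χ ∧ ∃ ψ, IsIrrChar Ghat ψ ∧ resChar G ψ = χ) ∨
    (_root_.bChar h2 x χ ≠ χ ∧ ∃ ψ, IsIrrChar Ghat ψ ∧
      resChar G ψ = χ + _root_.bChar h2 x χ ∧ ∀ h ∉ G, ψ h = 0) := by
  obtain ⟨ψ, hψ, hne⟩ := exists_isIrrChar_above hχ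
  change charInner χ (resChar G ψ) ≠ 0 at hne
  rcases hψ.resChar_cases h2 hx with h | ⟨χ', hχ', hb, hr, h0⟩
  · rw [hχ.charInner_eq h] at hne
    have : χ = resChar G ψ := by
      by_contra hc
      exact hne (if_neg hc)
    left
    rw [this]
    exact ⟨hψ.bChar_resChar h2 x, ψ, hψ, rfl⟩
  · right
    rw [hr, charInner_add_right, hχ.charInner_eq hχ', hχ.charInner_eq (hχ'.bChar h2 x)] at hne
    have : χ = χ' ∨ χ = _root_.bChar h2 x χ' := by
      by_contra! hc
      rw [if_neg hc.1, if_neg hc.2, add_zero] at hne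
      exact hne rfl
    rcases this with rfl | rfl
    · exact ⟨hb, ψ, hψ, hr, h0⟩
    · rw [hχ'.bChar_bChar]
      exact ⟨hb.symm, ψ, hψ, by rw [hr, add_comm], h0⟩

end IndexTwo

section Indicators

variable {Ghat : Type} [Group Ghat] {G : Subgroup Ghat} [Fintype Ghat]

theorem FS_eq {H : Type} [Group H] [Fintype H] (χ : H → ℂ) :
    FS H χ = (Nat.card H : ℂ)⁻¹ * ∑ g, χ (g ^ 2) := by
  rw [FS, finsum_eq_sum_of_fintype, div_eq_inv_mul]

theorem FSsharp_eq (h2 : G.index = 2) {x : Ghat} (hx : x ∉ G) (χ : G → ℂ) :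
    FSsharp G h2 χ = (Nat.card G : ℂ)⁻¹ *
      ∑ g : G, χ ⟨(g * x) ^ 2, Subgroup.sq_mem_of_index_two h2 _⟩ := by
  rw [FSsharp, div_eq_inv_mul,
    ← sum_notMem_eq h2 hx (fun h => χ ⟨(h : Ghat) ^ 2, Subgroup.sq_mem_of_index_two h2 _⟩),
    ← finsum_eq_sum_of_fintype]
  exact congrArg _ (finsum_subtype_eq_finsum_cond
    (f := fun h => χ ⟨h ^ 2, Subgroup.sq_mem_of_index_two h2 h⟩) (fun h => h ∉ G)).symm

theorem FSsharp_eq_twisted (h2 : G.index = 2) {x : Ghat} (hx : x ∉ G) (χ : G → ℂ) :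
    FSsharp G h2 χ = (Nat.card G : ℂ)⁻¹ *
      ∑ g : G, χ (g * conjEquiv h2 x g * ⟨x ^ 2, Subgroup.sq_mem_of_index_two h2 _⟩) := by
  rw [FSsharp_eq h2 hx]
  congr 1
  refine Finset.sum_congr rfl fun g _ => congrArg χ (Subtype.ext ?_)
  simp only [Subgroup.coe_mul, coe_conjEquiv, pow_two]
  group

theorem IsIrrChar.FS_cases {H : Type} [Group H] [Fintype H] {χ : H → ℂ} (hχ : IsIrrChar H χ) :
    FS H χ = -1 ∨ FS H χ = 0 ∨ FS H χ = 1 := by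
  have := hχ.twisted_indicator (MulEquiv.refl H) 1 (fun g => by simp) rfl
  simpa only [FS_eq, pow_two, MulEquiv.refl_apply, mul_one] using this

theorem IsIrrChar.FSsharp_cases {χ : G → ℂ} (hχ : IsIrrChar G χ) (h2 : G.index = 2) :
    FSsharp G h2 χ = -1 ∨ FSsharp G h2 χ = 0 ∨ FSsharp G h2 χ = 1 := by
  obtain ⟨x, hx⟩ := exists_notMem_of_index_two h2
  rw [FSsharp_eq_twisted h2 hx]
  refine hχ.twisted_indicator (conjEquiv h2 x) _ (fun g => Subtype.ext ?_) (Subtype.ext ?_)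
  · simp only [Subgroup.coe_mul, coe_conjEquiv, Subgroup.coe_inv, pow_two]
    group
  · simp only [coe_conjEquiv]
    group

theorem FS_add (χ χ' : G → ℂ) : FS G (χ + χ') = FS G χ + FS G χ' := by
  simp [FS_eq, Finset.sum_add_distrib, mul_add]

theorem FSsharp_add (h2 : G.index = 2) {x : Ghat} (hx : x ∉ G) (χ χ' : G → ℂ) :
    FSsharp G h2 (χ + χ') = FSsharp G h2 χ + FSsharp G h2 χ' := by
  simp [FSsharp_eq h2 hx, Finset.sum_add_distrib, mul_add]

theorem FS_bChar (h2 : G.index = 2) (x : Ghat) (χ : G → ℂ) :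
    FS G (bChar h2 x χ) = FS G χ := by
  rw [FS_eq, FS_eq, bChar_eq]
  congr 1
  exact Fintype.sum_equiv (conjEquiv h2 x).toEquiv _ _ fun g => by simp

theorem FSsharp_bChar (h2 : G.index = 2) {x : Ghat} (hx : x ∉ G) (χ : G → ℂ) :
    FSsharp G h2 (bChar h2 x χ) = FSsharp G h2 χ := by
  rw [FSsharp_eq h2 hx, FSsharp_eq h2 hx, bChar_eq]
  congr 1
  refine Fintype.sum_equiv (conjEquiv h2 x).toEquiv _ _ fun g => congrArg χ (Subtype.ext ?_)
  simp only [coe_conjEquiv, MulEquiv.toEquiv_eq_coe, MulEquiv.coe_toEquiv, pow_two]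
  group

theorem two_mul_FS (h2 : G.index = 2) {x : Ghat} (hx : x ∉ G) (ψ : Ghat → ℂ) :
    2 * FS Ghat ψ = FS G (resChar G ψ) + FSsharp G h2 (resChar G ψ) := by
  have hc : (Nat.card Ghat : ℂ) = 2 * Nat.card G := by
    rw [natCard_eq_two_mul h2]; push_cast; rfl
  have hG : (Nat.card G : ℂ) ≠ 0 := natCard_ne_zero
  rw [FS_eq, FS_eq, FSsharp_eq h2 hx, hc,
    ← Fintype.sum_subtype_add_sum_subtype (fun h => h ∈ G) (fun h => ψ (h ^ 2)),
    sum_notMem_eq h2 hx (fun h => ψ ((h : Ghat) ^ 2))]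
  simp only [resChar, Subgroup.coe_pow]
  have h1 : ∑ g : G, ψ ((g : Ghat) ^ 2) = ∑ g : {h // h ∈ G}, ψ ((g : Ghat) ^ 2) :=
    Fintype.sum_equiv (Equiv.refl _) _ _ fun _ => rfl
  rw [h1]
  field_simp

end Indicators

section Counting

theorem ncard_eq_two_mul_of_fibers {α β : Type*} (f : α → β) {s : Set α} {t : Set β}
    (hs : s.Finite) (ht : t.Finite) (hmaps : Set.MapsTo f s t)
    (hfib : ∀ b ∈ t, ∃ a a', a ≠ a' ∧ ∀ c, (c ∈ s ∧ f c = b) ↔ (c = a ∨ c = a')) :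
    s.ncard = 2 * t.ncard := by
  rw [Set.ncard_eq_toFinset_card _ hs, Set.ncard_eq_toFinset_card _ ht,
    Finset.card_eq_sum_card_fiberwise (f := f) (s := hs.toFinset) (t := ht.toFinset)
      (by simpa using hmaps), Finset.sum_const_nat (m := 2), mul_comm]
  intro b hb
  obtain ⟨a, a', hne, hiff⟩ := hfib b (ht.mem_toFinset.1 hb)
  rw [← Finset.card_pair hne]
  congr 1
  ext c
  simp [hiff c]

variable {Ghat : Type} [Group Ghat] {G : Subgroup Ghat} [Fintype Ghat]

theorem FS_of_resChar_eq (h2 : G.index = 2) {x : Ghat} (hx : x ∉ G) {ψ : Ghat → ℂ}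
    {χ : G → ℂ} (h : resChar G ψ = χ + bChar h2 x χ) :
    FS Ghat ψ = FS G χ + FSsharp G h2 χ := by
  have := two_mul_FS h2 hx ψ
  rw [h, FS_add, FSsharp_add h2 hx, FS_bChar, FSsharp_bChar h2 hx] at this
  linear_combination this / 2

theorem ncard_res_irreducible (h2 : G.index = 2) {x : Ghat} (hx : x ∉ G) :
    Set.ncard {ψ : Ghat → ℂ | (IsIrrChar Ghat ψ ∧ FS Ghat ψ = 1) ∧ IsIrrChar G (resChar G ψ)} =
      2 * Set.ncard {χ : G → ℂ | IsIrrChar G χ ∧ FS G χ = 1 ∧ FSsharp G h2 χ = 1} := by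
  refine ncard_eq_two_mul_of_fibers (resChar G)
    (finite_setOf_isIrrChar.subset fun ψ h => h.1.1)
    (finite_setOf_isIrrChar.subset fun χ h => h.1) ?_ ?_
  · rintro ψ ⟨⟨hψ, h1⟩, hr⟩
    have h := two_mul_FS h2 hx ψ
    rw [h1] at h
    refine ⟨hr, ?_⟩
    rcases hr.FS_cases with a | a | a <;> rcases hr.FSsharp_cases h2 with b | b | b <;>
      rw [a, b] at h <;> norm_num at h
    exact ⟨a, b⟩
  · rintro χ ⟨hχ, ha, hb⟩
    rcases hχ.exists_above_cases h2 hx with ⟨-, ψ, hψ, rfl⟩ | ⟨-, ψ, hψ, hr, -⟩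
    · have hres := charInner_resChar h2 ψ ψ
      rw [hχ.charInner_self, hψ.charInner_self, hψ.charInner_eq (hψ.signTwist h2)] at hres
      have hFS : ∀ φ : Ghat → ℂ, resChar G φ = resChar G ψ → FS Ghat φ = 1 := by
        intro φ hφ
        have := two_mul_FS h2 hx φ
        rw [hφ, ha, hb] at this
        linear_combination this / 2
      refine ⟨ψ, signTwist h2 ψ, fun h => ?_, fun φ => ⟨?_, ?_⟩⟩
      · rw [if_pos h] at hres
        norm_num at hres
      · rintro ⟨⟨⟨hφ, -⟩, -⟩, hr⟩
        have := charInner_resChar h2 φ ψ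
        rw [hr, hχ.charInner_self, hφ.charInner_eq hψ, hφ.charInner_eq (hψ.signTwist h2)] at this
        by_contra! hc
        rw [if_neg hc.1, if_neg hc.2] at this
        norm_num at this
      · rintro (rfl | rfl)
        · exact ⟨⟨⟨hψ, hFS _ rfl⟩, hχ⟩, rfl⟩
        · have hr := resChar_signTwist h2 ψ
          exact ⟨⟨⟨hψ.signTwist h2, hFS _ hr⟩, hr ▸ hχ⟩, hr⟩
    · have := FS_of_resChar_eq h2 hx hr
      rw [ha, hb] at this
      rcases hψ.FS_cases with a | a | a <;> rw [a] at this <;> norm_num at this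

/-- The induced class function of a function on a subgroup of index two. -/
noncomputable def indChar (h2 : G.index = 2) (x : Ghat) (χ : G → ℂ) : Ghat → ℂ :=
  fun h => if hh : h ∈ G then (χ + bChar h2 x χ) ⟨h, hh⟩ else 0

omit [Fintype Ghat] in
theorem resChar_indChar (h2 : G.index = 2) (x : Ghat) (χ : G → ℂ) :
    resChar G (indChar h2 x χ) = χ + bChar h2 x χ :=
  funext fun g => dif_pos g.2

omit [Fintype Ghat] in
theorem eq_indChar (h2 : G.index = 2) (x : Ghat) {χ : G → ℂ} {ψ : Ghat → ℂ}
    (hr : resChar G ψ = χ + bChar h2 x χ) (h0 : ∀ h ∉ G, ψ h = 0) : indChar h2 x χ = ψ := by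
  funext h
  by_cases hh : h ∈ G
  · exact congrFun ((resChar_indChar h2 x χ).trans hr.symm) ⟨h, hh⟩
  · rw [h0 h hh]
    exact dif_neg hh

theorem ncard_res_reducible (h2 : G.index = 2) {x : Ghat} (hx : x ∉ G) :
    Set.ncard ({χ : G → ℂ | IsIrrChar G χ ∧ FS G χ = 1 ∧ FSsharp G h2 χ = 0} ∪
        {χ : G → ℂ | IsIrrChar G χ ∧ FS G χ = 0 ∧ FSsharp G h2 χ = 1}) =
      2 * Set.ncard {ψ : Ghat → ℂ | (IsIrrChar Ghat ψ ∧ FS Ghat ψ = 1) ∧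
        ¬IsIrrChar G (resChar G ψ)} := by
  refine ncard_eq_two_mul_of_fibers (indChar h2 x)
    (finite_setOf_isIrrChar.subset fun χ h => h.elim (fun h => h.1) fun h => h.1)
    (finite_setOf_isIrrChar.subset fun ψ h => h.1.1) ?_ ?_
  · intro χ h
    have hχ : IsIrrChar G χ := h.elim (fun h => h.1) fun h => h.1
    have hsum : FS G χ + FSsharp G h2 χ = 1 := by
      rcases h with ⟨-, a, b⟩ | ⟨-, a, b⟩ <;> rw [a, b] <;> norm_num
    rcases hχ.exists_above_cases h2 hx with ⟨-, ψ, hψ, rfl⟩ | ⟨hb, ψ, hψ, hr, h0⟩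
    · have := two_mul_FS h2 hx ψ
      rw [hsum] at this
      rcases hψ.FS_cases with a | a | a <;> rw [a] at this <;> norm_num at this
    · rw [eq_indChar h2 x hr h0]
      refine ⟨⟨hψ, by rw [FS_of_resChar_eq h2 hx hr, hsum]⟩, fun hirr => ?_⟩
      have := hirr.charInner_self
      rw [hr, hχ.charInner_add_bChar, if_neg hb] at this
      norm_num at this
  · rintro ψ ⟨⟨hψ, h1⟩, hirr⟩
    obtain ⟨χ, hχ, hb, hr, h0⟩ := (hψ.resChar_cases h2 hx).resolve_left hirr
    have hFS := FS_of_resChar_eq h2 hx hr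
    have key : ∀ φ : G → ℂ, IsIrrChar G φ → FS G φ + FSsharp G h2 φ = 1 →
        φ ∈ ({χ : G → ℂ | IsIrrChar G χ ∧ FS G χ = 1 ∧ FSsharp G h2 χ = 0} ∪
          {χ : G → ℂ | IsIrrChar G χ ∧ FS G χ = 0 ∧ FSsharp G h2 χ = 1}) := by
      intro φ hφ h
      rcases hφ.FS_cases with a | a | a <;> rcases hφ.FSsharp_cases h2 with b | b | b <;>
        rw [a, b] at h <;> norm_num at h
      · exact Or.inr ⟨hφ, a, b⟩
      · exact Or.inl ⟨hφ, a, b⟩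
    refine ⟨χ, bChar h2 x χ, hb.symm, fun φ => ⟨?_, ?_⟩⟩
    · rintro ⟨h, rfl⟩
      have hφ : IsIrrChar G φ := h.elim (fun h => h.1) fun h => h.1
      rw [resChar_indChar] at hr
      have h3 := congrArg (charInner · χ) hr
      simp only [charInner_add_left, hχ.charInner_self, (hχ.bChar h2 x).charInner_eq hχ,
        hφ.charInner_eq hχ, (hφ.bChar h2 x).charInner_eq hχ] at h3
      rw [if_neg hb] at h3
      by_contra! hc
      have hc2 : bChar h2 x φ ≠ χ := fun h => hc.2 (by rw [← h, hφ.bChar_bChar])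
      rw [if_neg hc.1, if_neg hc2] at h3
      norm_num at h3
    · rintro (rfl | rfl)
      · exact ⟨key _ hχ (by rw [← hFS, h1]), eq_indChar h2 x hr h0⟩
      · refine ⟨key _ (hχ.bChar h2 x) ?_, eq_indChar h2 x ?_ h0⟩
        · rw [FS_bChar, FSsharp_bChar h2 hx, ← hFS, h1]
        · rw [hχ.bChar_bChar, add_comm, hr]

end Counting

/-- `4·N_I + N_III + N_V = 2·N̂_ℝ`. -/
theorem four_NI_add_NIII_add_NV {Ghat : Type} [Group Ghat] [Finite Ghat] (G : Subgroup Ghat)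
    (h2 : G.index = 2) :
    4 * Set.ncard {χ : ↥G → ℂ | IsIrrChar ↥G χ ∧ FS ↥G χ = 1 ∧ FSsharp G h2 χ = 1} +
      Set.ncard {χ : ↥G → ℂ | IsIrrChar ↥G χ ∧ FS ↥G χ = 1 ∧ FSsharp G h2 χ = 0} +
      Set.ncard {χ : ↥G → ℂ | IsIrrChar ↥G χ ∧ FS ↥G χ = 0 ∧ FSsharp G h2 χ = 1} =
    2 * Set.ncard {ψ : Ghat → ℂ | IsIrrChar Ghat ψ ∧ FS Ghat ψ = 1} := by
  cases nonempty_fintype Ghat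
  obtain ⟨x, hx⟩ := exists_notMem_of_index_two h2
  have hB := ncard_res_irreducible h2 hx
  have hA := ncard_res_reducible h2 hx
  have hfin : {ψ : Ghat → ℂ | IsIrrChar Ghat ψ ∧ FS Ghat ψ = 1}.Finite :=
    finite_setOf_isIrrChar.subset fun ψ h => h.1
  rw [Set.ncard_union_eq ?_ (finite_setOf_isIrrChar.subset fun χ h => h.1)
    (finite_setOf_isIrrChar.subset fun χ h => h.1)] at hA
  · have hT := Set.ncard_inter_add_ncard_sdiff_eq_ncard
      {ψ : Ghat → ℂ | IsIrrChar Ghat ψ ∧ FS Ghat ψ = 1}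
      {ψ : Ghat → ℂ | IsIrrChar G (resChar G ψ)} hfin
    change Set.ncard {ψ : Ghat → ℂ | (IsIrrChar Ghat ψ ∧ FS Ghat ψ = 1) ∧
      IsIrrChar G (resChar G ψ)} + Set.ncard {ψ : Ghat → ℂ | (IsIrrChar Ghat ψ ∧ FS Ghat ψ = 1) ∧
        ¬IsIrrChar G (resChar G ψ)} = _ at hT
    omega
  · rw [Set.disjoint_left]
    rintro χ ⟨-, a, -⟩ ⟨-, b, -⟩
    rw [a] at b
    exact one_ne_zero b
end
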